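/- Let Σ_Λ = {Σ_λ = (γ_λ,f_λ,g_λ)}_{λ∈Λ} and h⁰, h ∈ H satisfy Assumption 1 with φ_λ(t,r) = p(t)·φ̄(r) for all λ ∈ Λ, where p : [0,∞) → [0,∞) is locally integrable and φ̄ is continuous, and with α_λ(t,r) = ᾱ(r) for all λ ∈ Λ, where ᾱ is continuous and positive definite. Suppose −φ̄ is positive definite and there exists a constant θ > 0 such that γ_λ ∈ Γ^θ for all λ ∈ Λ, ∫_1^∞ ds/(−φ̄(s)) = ∞, and inf_{a>0} ∫_{ᾱ(a)}^a ds/(−φ̄(s)) > sup_{t≥0} ∫_t^{t+θ} p(s) ds. Then Σ_Λ is strongly (h⁰,h)-ISS. -/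

import Mathlib

open MeasureTheory Filter Set
open scoped Classical

noncomputable section

/-- State/input spaces: `ℝ^k` with the Euclidean norm. -/
abbrev Stt (k : ℕ) : Type := EuclideanSpace ℝ (Fin k)

/-- An impulse-time sequence, identified with its (locally finite) set of impulse
times, a subset of `(0,∞)` with finitely many points below any bound. -/
def IsImpulseSeq (γ : Set ℝ) : Prop :=
  γ ⊆ Set.Ioi (0 : ℝ) ∧ ∀ T : ℝ, (γ ∩ Set.Iic T).Finite

/-- `n^γ_{(s,t]}`: the number of impulse times in the interval `(s,t]`. -/
def nJumps (γ : Set ℝ) (s t : ℝ) : ℕ := (γ ∩ Set.Ioc s t).ncard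

/-- Uniform incremental boundedness of a set of impulse-time sequences. -/
def UIB (S : Set (Set ℝ)) : Prop :=
  ∃ φ : ℝ → ℝ, ContinuousOn φ (Set.Ici 0) ∧ MonotoneOn φ (Set.Ici 0) ∧
    (∀ s : ℝ, 0 ≤ s → 0 ≤ φ s) ∧
    ∀ γ ∈ S, ∀ t0 t : ℝ, 0 ≤ t0 → t0 < t → (nJumps γ t0 t : ℝ) ≤ φ (t - t0)

/-- Class `K∞` functions `[0,∞) → [0,∞)`. -/
def ClassKInf (α : ℝ → ℝ) : Prop :=
  ContinuousOn α (Set.Ici 0) ∧ StrictMonoOn α (Set.Ici 0) ∧ α 0 = 0 ∧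
    ∀ M : ℝ, ∃ r : ℝ, 0 ≤ r ∧ M ≤ α r

/-- Class `KL` functions. -/
def ClassKL (β : ℝ → ℝ → ℝ) : Prop :=
  (∀ t : ℝ, 0 ≤ t → ClassKInf fun r => β r t) ∧
  ∀ r : ℝ, 0 ≤ r → AntitoneOn (fun t => β r t) (Set.Ici 0) ∧
    Filter.Tendsto (fun t => β r t) Filter.atTop (nhds 0)

/-- Positive definite functions `[0,∞) → [0,∞)`. -/
def PosDef (ρ : ℝ → ℝ) : Prop :=
  ContinuousOn ρ (Set.Ici 0) ∧ ρ 0 = 0 ∧ ∀ r : ℝ, 0 < r → 0 < ρ r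

/-- Locally integrable (on compacts) function `[0,∞) → ℝ` (extended to `ℝ`). -/
def LocIntegrable (p : ℝ → ℝ) : Prop :=
  ∀ a b : ℝ, MeasureTheory.IntegrableOn p (Set.Icc a b)

/-- Inputs: measurable, locally essentially bounded functions. -/
def IsInput {m : ℕ} (u : ℝ → Stt m) : Prop :=
  Measurable u ∧ ∀ T : ℝ, ∃ C : ℝ, ∀ᵐ t ∂MeasureTheory.volume, t ∈ Set.Icc 0 T → ‖u t‖ ≤ C

/-- `‖u_I‖_γ`: max of the essential supremum of `‖u‖` over `I` and the supremum of
`‖u‖` over `γ ∩ I`. -/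
def inputNorm {m : ℕ} (γ : Set ℝ) (u : ℝ → Stt m) (I : Set ℝ) : ℝ :=
  max (essSup (fun t => ‖u t‖) (MeasureTheory.volume.restrict I))
      (sSup ((fun t => ‖u t‖) '' (γ ∩ I)))

/-- Solution of the impulsive system `(γ,f,g)` on `[t0,T)` with initial state `x0`
and input `u` (Carathéodory solutions, in integral form, between impulses). -/
structure IsSolution {n m : ℕ} (γ : Set ℝ) (f g : ℝ → Stt n → Stt m → Stt n)
    (t0 : ℝ) (x0 : Stt n) (u : ℝ → Stt m) (T : EReal) (x : ℝ → Stt n) : Prop where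
  lt : (t0 : EReal) < T
  init : x t0 = x0
  flow : ∀ t1 t2 : ℝ, t0 ≤ t1 → t1 ≤ t2 → (t2 : EReal) < T → Set.Ioc t1 t2 ∩ γ = ∅ →
    MeasureTheory.IntegrableOn (fun s => f s (x s) (u s)) (Set.Icc t1 t2) ∧
    x t2 = x t1 + ∫ s in t1..t2, f s (x s) (u s)
  jump : ∀ t ∈ γ, t0 < t → (t : EReal) < T →
    ∃ L : Stt n, Filter.Tendsto x (nhdsWithin t (Set.Iio t)) (nhds L) ∧
      x t = L + g t L (u t)

/-- Maximally defined solution. -/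
def IsMaxSolution {n m : ℕ} (γ : Set ℝ) (f g : ℝ → Stt n → Stt m → Stt n)
    (t0 : ℝ) (x0 : Stt n) (u : ℝ → Stt m) (T : EReal) (x : ℝ → Stt n) : Prop :=
  IsSolution γ f g t0 x0 u T x ∧
    ∀ (T' : EReal) (x' : ℝ → Stt n), IsSolution γ f g t0 x0 u T' x' →
      (∀ t : ℝ, t0 ≤ t → (t : EReal) < T → x' t = x t) → T' ≤ T

/-- Weak `(h⁰,h)`-ISS of a parametrized family of impulsive systems. -/
def WeaklyISS {n m : ℕ} {Λ : Type*} (γ : Λ → Set ℝ)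
    (f g : Λ → ℝ → Stt n → Stt m → Stt n) (h0 h : ℝ → Stt n → ℝ) : Prop :=
  ∃ β : ℝ → ℝ → ℝ, ∃ ρ : ℝ → ℝ, ClassKL β ∧ ClassKInf ρ ∧
    ∀ (l : Λ) (t0 : ℝ) (x0 : Stt n) (u : ℝ → Stt m) (T : EReal) (x : ℝ → Stt n),
      0 ≤ t0 → IsInput u → IsMaxSolution (γ l) (f l) (g l) t0 x0 u T x →
      ∀ t : ℝ, t0 ≤ t → (t : EReal) < T →
        h t (x t) ≤ β (h0 t0 x0) (t - t0) + ρ (inputNorm (γ l) u (Set.Ioc t0 t))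

/-- Strong `(h⁰,h)`-ISS of a parametrized family of impulsive systems. -/
def StronglyISS {n m : ℕ} {Λ : Type*} (γ : Λ → Set ℝ)
    (f g : Λ → ℝ → Stt n → Stt m → Stt n) (h0 h : ℝ → Stt n → ℝ) : Prop :=
  ∃ β : ℝ → ℝ → ℝ, ∃ ρ : ℝ → ℝ, ClassKL β ∧ ClassKInf ρ ∧
    ∀ (l : Λ) (t0 : ℝ) (x0 : Stt n) (u : ℝ → Stt m) (T : EReal) (x : ℝ → Stt n),
      0 ≤ t0 → IsInput u → IsMaxSolution (γ l) (f l) (g l) t0 x0 u T x →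
      ∀ t : ℝ, t0 ≤ t → (t : EReal) < T →
        h t (x t) ≤ β (h0 t0 x0) (t - t0 + (nJumps (γ l) t0 t : ℝ)) +
          ρ (inputNorm (γ l) u (Set.Ioc t0 t))

/-- Locally Lipschitz on a set. -/
def LocLipschitzOn {α β : Type*} [PseudoEMetricSpace α] [PseudoEMetricSpace β]
    (s : Set α) (f : α → β) : Prop :=
  ∀ x ∈ s, ∃ K : NNReal, ∃ t ∈ nhdsWithin x s, LipschitzOnWith K f t

/-- `V ∈ V(γ)` with `Vm` its left-limit function at impulse times: `V` is locally
Lipschitz on each inter-impulse strip and has the joint left limit `Vm τ ξ`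
at each `τ ∈ γ`. -/
def InClassV {n : ℕ} (γ : Set ℝ) (V Vm : ℝ → Stt n → ℝ) : Prop :=
  (∀ a b : ℝ, 0 ≤ a → Set.Ioo a b ∩ γ = ∅ →
    LocLipschitzOn (Set.Ico a b ×ˢ (Set.univ : Set (Stt n)))
      (fun q : ℝ × Stt n => V q.1 q.2)) ∧
  ∀ τ ∈ γ, ∀ ξ : Stt n,
    Filter.Tendsto (fun q : ℝ × Stt n => V q.1 q.2)
      (nhdsWithin (τ, ξ) (Set.Iio τ ×ˢ (Set.univ : Set (Stt n)))) (nhds (Vm τ ξ))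

/-- Upper-right Dini derivative of `V` along the flow map `f`. -/
def DiniAlong {n m : ℕ} (f : ℝ → Stt n → Stt m → Stt n) (V : ℝ → Stt n → ℝ)
    (t : ℝ) (ξ : Stt n) (μ : Stt m) : ℝ :=
  Filter.limsup (fun d : ℝ => (V (t + d) (ξ + d • f t ξ μ) - V t ξ) / d)
    (nhdsWithin 0 (Set.Ioi 0))

/-- Carathéodory function `[0,∞) × [0,∞) → ℝ`. -/
def Caratheodory2 (φ : ℝ → ℝ → ℝ) : Prop :=
  (∀ r : ℝ, Measurable fun t => φ t r) ∧
  (∀ t : ℝ, ContinuousOn (φ t) (Set.Ici 0)) ∧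
  ∀ a b c : ℝ, ∃ mK : ℝ → ℝ, MeasureTheory.IntegrableOn mK (Set.Icc a b) ∧
    ∀ t ∈ Set.Icc a b, ∀ r ∈ Set.Icc (0 : ℝ) c, |φ t r| ≤ mK t

/-- Assumption 1 of the paper, with all the data explicit. -/
def Assumption1 {n m : ℕ} {Λ : Type*} (γ : Λ → Set ℝ)
    (f g : Λ → ℝ → Stt n → Stt m → Stt n) (h0 h : ℝ → Stt n → ℝ)
    (V Vm : Λ → ℝ → Stt n → ℝ) (φ1 φ2 χ π : ℝ → ℝ)
    (vφ al : Λ → ℝ → ℝ → ℝ) : Prop :=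
  ClassKInf φ1 ∧ ClassKInf φ2 ∧ ClassKInf χ ∧ ClassKInf π ∧
  (∀ l : Λ, InClassV (γ l) (V l) (Vm l)) ∧
  (∀ l : Λ, Caratheodory2 (vφ l)) ∧
  (∀ (l : Λ) (t r : ℝ), 0 ≤ t → 0 ≤ r → 0 ≤ al l t r) ∧
  (∀ (l : Λ) (t : ℝ) (ξ : Stt n), 0 ≤ t →
    φ1 (h t ξ) ≤ V l t ξ ∧ V l t ξ ≤ φ2 (h0 t ξ)) ∧
  (∀ (l : Λ) (t : ℝ) (ξ : Stt n) (μ : Stt m), 0 ≤ t → t ∉ γ l → χ ‖μ‖ ≤ V l t ξ →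
    DiniAlong (f l) (V l) t ξ μ ≤ - vφ l t (V l t ξ)) ∧
  (∀ (l : Λ) (t : ℝ) (ξ : Stt n) (μ : Stt m), t ∈ γ l → χ ‖μ‖ ≤ Vm l t ξ →
    V l t (ξ + g l t ξ μ) ≤ al l t (Vm l t ξ)) ∧
  (∀ (l : Λ) (t : ℝ) (ξ : Stt n) (μ : Stt m), t ∈ γ l → Vm l t ξ ≤ χ ‖μ‖ →
    V l t (ξ + g l t ξ μ) ≤ π ‖μ‖)

/-- Solution of the scalar comparison differential/difference inclusion. -/
structure IsCompSol (γ : Set ℝ) (vφ al : ℝ → ℝ → ℝ) (t0 z0 : ℝ) (T : EReal)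
    (z : ℝ → ℝ) : Prop where
  lt : (t0 : EReal) < T
  init : z t0 = z0
  nonneg : ∀ t : ℝ, t0 ≤ t → (t : EReal) < T → 0 ≤ z t
  flow : ∀ t1 t2 : ℝ, t0 ≤ t1 → t1 ≤ t2 → (t2 : EReal) < T → Set.Ioc t1 t2 ∩ γ = ∅ →
    ∃ d : ℝ → ℝ, MeasureTheory.IntegrableOn d (Set.Icc t1 t2) ∧
      (∀ᵐ s ∂MeasureTheory.volume, s ∈ Set.Icc t1 t2 → d s ≤ - vφ s (z s)) ∧
      ∀ t ∈ Set.Icc t1 t2, z t = z t1 + ∫ s in t1..t, d s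
  jump : ∀ t ∈ γ, t0 < t → (t : EReal) < T →
    ∃ L : ℝ, Filter.Tendsto z (nhdsWithin t (Set.Iio t)) (nhds L) ∧ z t ≤ al t L

/-- The family of comparison systems is weakly GUAS. -/
def CompWeakGUAS {Λ : Type*} (γ : Λ → Set ℝ) (vφ al : Λ → ℝ → ℝ → ℝ) : Prop :=
  ∃ β : ℝ → ℝ → ℝ, ClassKL β ∧
    ∀ (l : Λ) (t0 z0 : ℝ) (T : EReal) (z : ℝ → ℝ), 0 ≤ t0 → 0 ≤ z0 →
      IsCompSol (γ l) (vφ l) (al l) t0 z0 T z →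
      ∀ t : ℝ, t0 ≤ t → (t : EReal) < T → z t ≤ β z0 (t - t0)

/-- The family of comparison systems is strongly GUAS. -/
def CompStrongGUAS {Λ : Type*} (γ : Λ → Set ℝ) (vφ al : Λ → ℝ → ℝ → ℝ) : Prop :=
  ∃ β : ℝ → ℝ → ℝ, ClassKL β ∧
    ∀ (l : Λ) (t0 z0 : ℝ) (T : EReal) (z : ℝ → ℝ), 0 ≤ t0 → 0 ≤ z0 →
      IsCompSol (γ l) (vφ l) (al l) t0 z0 T z →
      ∀ t : ℝ, t0 ≤ t → (t : EReal) < T → z t ≤ β z0 (t - t0 + (nJumps (γ l) t0 t : ℝ))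

/-- Nonnegative Carathéodory solution of the scalar ODE `ẇ = rhs(t,w)` on `[t0,T)`. -/
structure IsODESol (rhs : ℝ → ℝ → ℝ) (t0 : ℝ) (T : EReal) (w : ℝ → ℝ) : Prop where
  lt : (t0 : EReal) < T
  nonneg : ∀ t : ℝ, t0 ≤ t → (t : EReal) < T → 0 ≤ w t
  flow : ∀ t1 t2 : ℝ, t0 ≤ t1 → t1 ≤ t2 → (t2 : EReal) < T →
    IntervalIntegrable (fun s => rhs s (w s)) MeasureTheory.volume t1 t2 ∧
    w t2 = w t1 + ∫ s in t1..t2, rhs s (w s)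

/-- Maximally defined forward-in-time solution of `ẇ = rhs(t,w)`. -/
def IsMaxODESol (rhs : ℝ → ℝ → ℝ) (t0 : ℝ) (T : EReal) (w : ℝ → ℝ) : Prop :=
  IsODESol rhs t0 T w ∧
    ∀ (T' : EReal) (w' : ℝ → ℝ), IsODESol rhs t0 T' w' →
      (∀ t : ℝ, t0 ≤ t → (t : EReal) < T → w' t = w t) → T' ≤ T

/-- GUAS of the family of scalar ODEs `ẇ = −φ_λ(t,w)`. -/
def ODEFamilyGUAS {Λ : Type*} (vφ : Λ → ℝ → ℝ → ℝ) : Prop :=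
  ∃ β : ℝ → ℝ → ℝ, ClassKL β ∧
    ∀ (l : Λ) (t0 : ℝ) (T : EReal) (w : ℝ → ℝ), 0 ≤ t0 →
      IsMaxODESol (fun s r => -(vφ l s r)) t0 T w →
      T = (⊤ : EReal) ∧ ∀ t : ℝ, t0 ≤ t → w t ≤ β (w t0) (t - t0)

/-- Solution (on all of `[0,∞)`) of the scalar linear ODE `ẇ = −p(t)·w`. -/
def IsLinSol (p : ℝ → ℝ) (w : ℝ → ℝ) : Prop :=
  ∀ t1 t2 : ℝ, 0 ≤ t1 → t1 ≤ t2 →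
    IntervalIntegrable (fun s => p s * w s) MeasureTheory.volume t1 t2 ∧
    w t2 = w t1 + ∫ s in t1..t2, -(p s * w s)

/-- An impulsive and switching sequence, described through its impulse-time set,
its two switching signals (constant between impulses), and the left limit of the
first switching signal at impulse times. -/
structure SwSignal (Ic Id : Type*) where
  γ : Set ℝ
  σ1 : ℝ → Ic
  σ1m : ℝ → Ic
  σ2 : ℝ → Id
  impulse : IsImpulseSeq γ
  const1 : ∀ a b : ℝ, 0 ≤ a → Set.Ioo a b ∩ γ = ∅ → ∀ t ∈ Set.Ico a b, σ1 t = σ1 a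
  const2 : ∀ a b : ℝ, 0 ≤ a → Set.Ioo a b ∩ γ = ∅ → ∀ t ∈ Set.Ico a b, σ2 t = σ2 a
  leftlim : ∀ t ∈ γ, ∀ᶠ s in nhdsWithin t (Set.Iio t), σ1 s = σ1m t

/-- `σ ∈ SW(J)`. -/
def InSW {Ic Id : Type*} (σ : SwSignal Ic Id) (J : Set (Ic × Ic × Id)) : Prop :=
  ∀ t ∈ σ.γ, (σ.σ1m t, σ.σ1 t, σ.σ2 t) ∈ J

/-- Flow map of the switched impulsive system `Σ_σ`. -/
def swF {n m : ℕ} {Ic Id : Type*} (F : Ic → ℝ → Stt n → Stt m → Stt n)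
    (σ : SwSignal Ic Id) : ℝ → Stt n → Stt m → Stt n :=
  fun t ξ μ => F (σ.σ1 t) t ξ μ

/-- Jump map of the switched impulsive system `Σ_σ`. -/
def swG {n m : ℕ} {Ic Id : Type*} (G : Id → ℝ → Stt n → Stt m → Stt n)
    (σ : SwSignal Ic Id) : ℝ → Stt n → Stt m → Stt n :=
  fun t ξ μ => G (σ.σ2 t) t ξ μ

/-- Weak `(h⁰,h)`-ISS of the family `{Σ_σ}_{σ ∈ SW}`. -/
def SwWeaklyISS {n m : ℕ} {Ic Id : Type*} (F : Ic → ℝ → Stt n → Stt m → Stt n)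
    (G : Id → ℝ → Stt n → Stt m → Stt n) (SW : Set (SwSignal Ic Id))
    (h0 h : ℝ → Stt n → ℝ) : Prop :=
  ∃ β : ℝ → ℝ → ℝ, ∃ ρ : ℝ → ℝ, ClassKL β ∧ ClassKInf ρ ∧
    ∀ σ ∈ SW, ∀ (t0 : ℝ) (x0 : Stt n) (u : ℝ → Stt m) (T : EReal) (x : ℝ → Stt n),
      0 ≤ t0 → IsInput u → IsMaxSolution σ.γ (swF F σ) (swG G σ) t0 x0 u T x →
      ∀ t : ℝ, t0 ≤ t → (t : EReal) < T →
        h t (x t) ≤ β (h0 t0 x0) (t - t0) + ρ (inputNorm σ.γ u (Set.Ioc t0 t))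

/-- Strong `(h⁰,h)`-ISS of the family `{Σ_σ}_{σ ∈ SW}`. -/
def SwStronglyISS {n m : ℕ} {Ic Id : Type*} (F : Ic → ℝ → Stt n → Stt m → Stt n)
    (G : Id → ℝ → Stt n → Stt m → Stt n) (SW : Set (SwSignal Ic Id))
    (h0 h : ℝ → Stt n → ℝ) : Prop :=
  ∃ β : ℝ → ℝ → ℝ, ∃ ρ : ℝ → ℝ, ClassKL β ∧ ClassKInf ρ ∧
    ∀ σ ∈ SW, ∀ (t0 : ℝ) (x0 : Stt n) (u : ℝ → Stt m) (T : EReal) (x : ℝ → Stt n),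
      0 ≤ t0 → IsInput u → IsMaxSolution σ.γ (swF F σ) (swG G σ) t0 x0 u T x →
      ∀ t : ℝ, t0 ≤ t → (t : EReal) < T →
        h t (x t) ≤ β (h0 t0 x0) (t - t0 + (nJumps σ.γ t0 t : ℝ)) +
          ρ (inputNorm σ.γ u (Set.Ioc t0 t))

/-- Total activation time in `(t0,t]` of the flow modes in `A`. -/
def actT {Ic Id : Type*} (σ : SwSignal Ic Id) (A : Set Ic) (t0 t : ℝ) : ℝ :=
  (MeasureTheory.volume {r : ℝ | r ∈ Set.Ioc t0 t ∧ σ.σ1 r ∈ A}).toReal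

/-- Number of impulse times in `(t0,t]` whose mode combination lies in `Jp`. -/
def nJumpsIn {Ic Id : Type*} (σ : SwSignal Ic Id) (Jp : Set (Ic × Ic × Id))
    (t0 t : ℝ) : ℕ :=
  (σ.γ ∩ Set.Ioc t0 t ∩ {r : ℝ | (σ.σ1m r, σ.σ1 r, σ.σ2 r) ∈ Jp}).ncard

/-- Assumption 2 of the paper (for switched impulsive systems), data explicit. -/
def Assumption2 {n m : ℕ} {Ic Id : Type*}
    (F : Ic → ℝ → Stt n → Stt m → Stt n) (G : Id → ℝ → Stt n → Stt m → Stt n)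
    (h0 h : ℝ → Stt n → ℝ) (J : Set (Ic × Ic × Id))
    (v : Ic → ℝ → Stt n → ℝ) (φ1 φ2 χ π : ℝ → ℝ)
    (vφ : Ic → ℝ → ℝ → ℝ) (al : Ic × Ic × Id → ℝ → ℝ → ℝ) : Prop :=
  ClassKInf φ1 ∧ ClassKInf φ2 ∧ ClassKInf χ ∧ ClassKInf π ∧
  (∀ i : Ic, LocLipschitzOn ((Set.Ici (0 : ℝ)) ×ˢ (Set.univ : Set (Stt n)))
      (fun q : ℝ × Stt n => v i q.1 q.2)) ∧
  (∀ i : Ic, Caratheodory2 (vφ i)) ∧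
  (∀ e ∈ J, ∀ t r : ℝ, 0 ≤ t → 0 ≤ r → 0 ≤ al e t r) ∧
  (∀ (i : Ic) (t : ℝ) (ξ : Stt n), 0 ≤ t →
    φ1 (h t ξ) ≤ v i t ξ ∧ v i t ξ ≤ φ2 (h0 t ξ)) ∧
  (∀ (i : Ic) (t : ℝ) (ξ : Stt n) (μ : Stt m), 0 ≤ t → χ ‖μ‖ ≤ v i t ξ →
    DiniAlong (F i) (v i) t ξ μ ≤ - vφ i t (v i t ξ)) ∧
  (∀ (ι i : Ic) (j : Id), (ι, i, j) ∈ J → ∀ (t : ℝ) (ξ : Stt n) (μ : Stt m),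
    0 ≤ t → χ ‖μ‖ ≤ v ι t ξ → v i t (ξ + G j t ξ μ) ≤ al (ι, i, j) t (v ι t ξ)) ∧
  (∀ (ι i : Ic) (j : Id), (ι, i, j) ∈ J → ∀ (t : ℝ) (ξ : Stt n) (μ : Stt m),
    0 ≤ t → v ι t ξ ≤ χ ‖μ‖ → v i t (ξ + G j t ξ μ) ≤ π ‖μ‖)

/-- A function whose increments are dominated by those of an absolutely continuous function is
absolutely continuous. -/
theorem AbsolutelyContinuousOnInterval.of_dist_le {X Y : Type*} [PseudoMetricSpace X]
    [PseudoMetricSpace Y] {W : ℝ → X} {P : ℝ → Y} {a b K : ℝ}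
    (hP : AbsolutelyContinuousOnInterval P a b)
    (h : ∀ s ∈ uIcc a b, ∀ t ∈ uIcc a b, dist (W s) (W t) ≤ K * dist (P s) (P t)) :
    AbsolutelyContinuousOnInterval W a b := by
  have h0 := Filter.Tendsto.const_mul K hP
  rw [mul_zero] at h0
  refine squeeze_zero' (Eventually.of_forall fun E => Finset.sum_nonneg fun i _ => dist_nonneg)
    ?_ h0
  filter_upwards [mem_inf_of_right (mem_principal_self _)] with E hE
  rw [Finset.mul_sum]
  exact Finset.sum_le_sum fun i hi => h _ (hE.1 i hi).1 _ (hE.1 i hi).2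

/-- A locally Lipschitz function along an integral curve is absolutely continuous, and almost
everywhere its derivative is the upper-right Dini derivative along the velocity. -/
theorem LocLipschitzOn.along_curve {E : Type*} [NormedAddCommGroup E] [NormedSpace ℝ E]
    [CompleteSpace E] {V : ℝ → E → ℝ} {x v : ℝ → E} {a b t1 t2 : ℝ}
    (hV : LocLipschitzOn (Ico a b ×ˢ (univ : Set E)) fun q : ℝ × E => V q.1 q.2)
    (ha : a ≤ t1) (h12 : t1 ≤ t2) (hb : t2 < b) (hv : IntegrableOn v (Icc t1 t2))
    (hx : ∀ t ∈ Icc t1 t2, x t = x t1 + ∫ s in t1..t, v s) :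
    AbsolutelyContinuousOnInterval (fun t => V t (x t)) t1 t2 ∧
    ∀ᵐ t, t ∈ Ioo t1 t2 → ∃ w, HasDerivAt (fun t => V t (x t)) w t ∧
      limsup (fun d : ℝ => (V (t + d) (x t + d • v t) - V t (x t)) / d) (nhdsWithin 0 (Ioi 0))
        = w := by
  have hvi : IntervalIntegrable v volume t1 t2 :=
    (intervalIntegrable_iff_integrableOn_Icc_of_le h12).2 hv
  have hsub : ∀ s ∈ Icc t1 t2, ∀ t ∈ Icc t1 t2, IntervalIntegrable v volume s t := by
    intro s hs t ht
    refine hvi.mono_set ?_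
    rw [uIcc_of_le h12]
    exact ordConnected_Icc.uIcc_subset hs ht
  have hxd : ∀ s ∈ Icc t1 t2, ∀ t ∈ Icc t1 t2, x t - x s = ∫ r in s..t, v r := by
    intro s hs t ht
    rw [hx t ht, hx s hs, add_sub_add_left_eq_sub, intervalIntegral.integral_interval_sub_left
      (hsub _ (left_mem_Icc.2 h12) _ ht) (hsub _ (left_mem_Icc.2 h12) _ hs)]
  have hxc : ContinuousOn x (Icc t1 t2) := by
    have : ContinuousOn (fun t => x t1 + ∫ s in t1..t, v s) (Icc t1 t2) := by
      have := intervalIntegral.continuousOn_primitive_interval (by rwa [uIcc_of_le h12])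
        (μ := volume) (f := v) (a := t1) (b := t2)
      rw [uIcc_of_le h12] at this
      exact continuousOn_const.add this
    exact this.congr hx
  set P : ℝ → ℝ := fun t => t + ∫ s in t1..t, ‖v s‖ with hPdef
  have hP : AbsolutelyContinuousOnInterval P t1 t2 := by
    refine AbsolutelyContinuousOnInterval.add (f := fun t => t) ?_ ?_
    · exact (LipschitzWith.id.lipschitzOnWith).absolutelyContinuousOnInterval
    · exact hvi.norm.absolutelyContinuousOnInterval_intervalIntegral left_mem_uIcc
  set S : Set (ℝ × E) := (fun t => (t, x t)) '' Icc t1 t2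
  have hS : IsCompact S := isCompact_Icc.image_of_continuousOn (continuousOn_id.prodMk hxc)
  have hSsub : S ⊆ Ico a b ×ˢ (univ : Set E) := by
    rintro _ ⟨t, ht, rfl⟩
    exact ⟨⟨ha.trans ht.1, ht.2.trans_lt hb⟩, mem_univ _⟩
  obtain ⟨K, hK⟩ := LocallyLipschitzOn.exists_lipschitzOnWith_of_compact hS
    (LocallyLipschitzOn.mono (t := Ico a b ×ˢ (univ : Set E)) (fun q hq => hV q hq) hSsub)
  have hPd : ∀ s ∈ Icc t1 t2, ∀ t ∈ Icc t1 t2, s ≤ t →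
      max (dist s t) (dist (x s) (x t)) ≤ dist (P s) (P t) := by
    intro s hs t ht hst
    have h1 : P t - P s = (t - s) + ∫ r in s..t, ‖v r‖ := by
      rw [hPdef, ← intervalIntegral.integral_interval_sub_left
        (hsub _ (left_mem_Icc.2 h12) _ ht).norm (hsub _ (left_mem_Icc.2 h12) _ hs).norm]
      ring
    have h2 : 0 ≤ ∫ r in s..t, ‖v r‖ := intervalIntegral.integral_nonneg hst fun _ _ => norm_nonneg _
    rw [dist_comm (P s), Real.dist_eq (P t), h1, abs_of_nonneg (a := t - s + _) (by linarith),
      dist_comm s, Real.dist_eq, abs_of_nonneg (by linarith), dist_comm (x s), dist_eq_norm,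
      hxd s hs t ht]
    have h3 := intervalIntegral.norm_integral_le_integral_norm hst (f := v) (μ := volume)
    exact max_le (by linarith) (by linarith)
  have hWAC : AbsolutelyContinuousOnInterval (fun t => V t (x t)) t1 t2 := by
    refine hP.of_dist_le (K := K) ?_
    rw [uIcc_of_le h12]
    have key : ∀ s ∈ Icc t1 t2, ∀ t ∈ Icc t1 t2, s ≤ t →
        dist (V s (x s)) (V t (x t)) ≤ K * dist (P s) (P t) := by
      intro s hs t ht hst
      refine (hK.dist_le_mul _ (mem_image_of_mem _ hs) _ (mem_image_of_mem _ ht)).trans ?_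
      exact mul_le_mul_of_nonneg_left (hPd s hs t ht hst) K.2
    intro s hs t ht
    rcases le_total s t with h | h
    · exact key s hs t ht h
    · rw [dist_comm, dist_comm (P s)]
      exact key t ht s hs h
  refine ⟨hWAC, ?_⟩
  filter_upwards [hWAC.ae_differentiableAt, hvi.ae_hasDerivAt_integral] with t hW hd ht
  have htI : t ∈ uIcc t1 t2 := by
    rw [uIcc_of_le h12]; exact Ioo_subset_Icc_self ht
  have hWd := (hW htI).hasDerivAt
  refine ⟨_, hWd, ?_⟩
  have hxt : HasDerivAt x (v t) t := by
    refine ((hd htI t1 left_mem_uIcc).const_add (x t1)).congr_of_eventuallyEq ?_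
    filter_upwards [Ioo_mem_nhds ht.1 ht.2] with s hs using hx s (Ioo_subset_Icc_self hs)
  refine Tendsto.limsup_eq ?_
  have hmem : ((t, x t) : ℝ × E) ∈ Ico a b ×ˢ (univ : Set E) :=
    ⟨⟨ha.trans ht.1.le, ht.2.trans hb⟩, mem_univ _⟩
  obtain ⟨K', U, hU, hLip⟩ := hV _ hmem
  have hU' : U ∈ nhds ((t, x t) : ℝ × E) := by
    rwa [nhdsWithin_eq_nhds.2 (prod_mem_nhds
      (Ico_mem_nhds (ha.trans_lt ht.1) (ht.2.trans hb)) univ_mem)] at hU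
  have hadd : Tendsto (fun d : ℝ => t + d) (nhdsWithin 0 (Ioi 0)) (nhds t) := by
    have : Tendsto (fun d : ℝ => t + d) (nhds 0) (nhds (t + 0)) :=
      tendsto_const_nhds.add tendsto_id
    rw [add_zero] at this
    exact this.mono_left nhdsWithin_le_nhds
  have h1 : ∀ᶠ d in nhdsWithin (0 : ℝ) (Ioi 0), (t + d, x (t + d)) ∈ U :=
    (hadd.prodMk_nhds (hxt.continuousAt.tendsto.comp hadd)) hU'
  have h2 : ∀ᶠ d in nhdsWithin (0 : ℝ) (Ioi 0), (t + d, x t + d • v t) ∈ U := by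
    refine (hadd.prodMk_nhds (?_ : Tendsto _ _ (nhds (x t)))) hU'
    have : Tendsto (fun d : ℝ => x t + d • v t) (nhds 0) (nhds (x t + (0 : ℝ) • v t)) :=
      tendsto_const_nhds.add (tendsto_id.smul_const _)
    rw [zero_smul, add_zero] at this
    exact this.mono_left nhdsWithin_le_nhds
  have hs1 := hWd.tendsto_slope_zero_right
  have hs2 := hxt.tendsto_slope_zero_right
  have hs3 : Tendsto (fun d : ℝ => (K' : ℝ) * ‖d⁻¹ • (x (t + d) - x t) - v t‖)
      (nhdsWithin 0 (Ioi 0)) (nhds 0) := by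
    have := ((hs2.sub_const (v t)).norm).const_mul (K' : ℝ)
    simpa using this
  have hs4 : Tendsto (fun d : ℝ => (V (t + d) (x t + d • v t) - V t (x t)) / d -
      d⁻¹ • (V (t + d) (x (t + d)) - V t (x t))) (nhdsWithin 0 (Ioi 0)) (nhds 0) := by
    refine squeeze_zero_norm' ?_ hs3
    filter_upwards [h1, h2, self_mem_nhdsWithin] with d hd1 hd2 hd0
    have hd0 : 0 < d := hd0
    have := hLip.dist_le_mul _ hd2 _ hd1
    have e1 : dist ((t + d, x t + d • v t) : ℝ × E) (t + d, x (t + d)) =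
        d * ‖d⁻¹ • (x (t + d) - x t) - v t‖ := by
      rw [Prod.dist_eq]
      simp only [dist_self]
      rw [max_eq_right dist_nonneg, dist_comm, dist_eq_norm, ← abs_of_pos hd0, ← Real.norm_eq_abs,
        ← norm_smul, Real.norm_eq_abs, abs_of_pos hd0, smul_sub, smul_inv_smul₀ hd0.ne']
      congr 1; abel
    rw [e1] at this
    rw [smul_eq_mul, div_eq_inv_mul, ← mul_sub, sub_sub_sub_cancel_right, norm_mul, norm_inv,
      Real.norm_eq_abs, abs_of_pos hd0, ← dist_eq_norm, inv_mul_le_iff₀ hd0, mul_left_comm]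
    exact this
  have := hs4.add hs1
  simpa using this

/-- Scalar comparison: if `W` grows at rate at most `p t * q (W t)` while above the level `R`, then
a primitive `Fn` of `1 / q`, evaluated at `max W R`, grows at rate at most `p`. -/
theorem primitive_max_le_add_integral {W p q Fn : ℝ → ℝ} {t1 t2 R : ℝ} (h12 : t1 ≤ t2)
    (hR : 0 < R) (hW : AbsolutelyContinuousOnInterval W t1 t2)
    (hq : ContinuousOn q (Ici 0)) (hq0 : ∀ r, 0 < r → 0 < q r)
    (hFd : ∀ r, 0 < r → HasDerivAt Fn (q r)⁻¹ r) (hFm : StrictMonoOn Fn (Ioi 0))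
    (hp : IntegrableOn p (Icc t1 t2)) (hp0 : ∀ t ∈ Icc t1 t2, 0 ≤ p t)
    (hd : ∀ᵐ t, t ∈ Ioo t1 t2 → R < W t → ∃ w, HasDerivAt W w t ∧ w ≤ p t * q (W t)) :
    Fn (max (W t2) R) ≤ Fn (max (W t1) R) + ∫ t in t1..t2, p t := by
  obtain ⟨M, hM⟩ := hW.exists_bound
  have hIcc : ∀ t ∈ uIcc t1 t2, max (W t) R ∈ Icc R (max M R) := fun t ht =>
    ⟨le_max_right _ _, max_le_max_right _ ((le_abs_self _).trans (hM t ht))⟩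
  have hqc : ContinuousOn (fun r => (q r)⁻¹) (Icc R (max M R)) :=
    (hq.mono fun r hr => hR.le.trans hr.1).inv₀ fun r hr => (hq0 r (hR.trans_le hr.1)).ne'
  obtain ⟨C, hC⟩ := isCompact_Icc.exists_bound_of_continuousOn hqc
  have hC0 : 0 ≤ C := (norm_nonneg _).trans (hC R ⟨le_rfl, le_max_right _ _⟩)
  have hG : AbsolutelyContinuousOnInterval (fun t => Fn (max (W t) R)) t1 t2 := by
    refine hW.of_dist_le (K := C) fun s hs t ht => ?_
    have := (convex_Icc R (max M R)).norm_image_sub_le_of_norm_hasDerivWithin_le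
      (fun r hr => (hFd r (hR.trans_le hr.1)).hasDerivWithinAt) hC (hIcc t ht) (hIcc s hs)
    rw [dist_eq_norm]
    refine this.trans (mul_le_mul_of_nonneg_left ?_ hC0)
    rw [Real.dist_eq]
    exact abs_max_sub_max_le_abs _ _ _
  have hle : (deriv fun t => Fn (max (W t) R)) ≤ᵐ[volume.restrict (Icc t1 t2)] p := by
    rw [← Measure.restrict_congr_set Ioo_ae_eq_Icc]
    refine (ae_restrict_iff' measurableSet_Ioo).2 ?_
    filter_upwards [hd, hG.ae_differentiableAt] with t ht hGd htI
    have htI' : t ∈ uIcc t1 t2 := by rw [uIcc_of_le h12]; exact Ioo_subset_Icc_self htI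
    have hWc : ContinuousAt W t := by
      refine hW.continuousOn.continuousAt ?_
      rw [uIcc_of_le h12]; exact Icc_mem_nhds htI.1 htI.2
    rcases lt_or_ge R (W t) with h | h
    · obtain ⟨w, hw, hwle⟩ := ht htI h
      have h1 : HasDerivAt (fun t => Fn (max (W t) R)) ((q (W t))⁻¹ * w) t := by
        refine ((hFd (W t) (hR.trans h)).comp t hw).congr_of_eventuallyEq ?_
        filter_upwards [hWc.eventually (lt_mem_nhds h)] with s hs
        simp [max_eq_left hs.le]
      rw [h1.deriv, inv_mul_le_iff₀ (hq0 _ (hR.trans h)), mul_comm]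
      exact hwle
    · have hmin : IsLocalMin (fun t => Fn (max (W t) R)) t := by
        refine Eventually.of_forall fun s => ?_
        simp only [max_eq_right h]
        exact hFm.monotoneOn hR (hR.trans_le (le_max_right _ _)) (le_max_right _ _)
      rw [hmin.deriv_eq_zero]
      exact hp0 t (Ioo_subset_Icc_self htI)
  have := intervalIntegral.integral_mono_ae_restrict h12 hG.intervalIntegrable_deriv
    ((intervalIntegrable_iff_integrableOn_Icc_of_le h12).2 hp) hle
  rw [hG.integral_deriv_eq_sub] at this
  linarith

/-- A primitive of `1 / q` on `(0,∞)` that maps `(0,∞)` bijectively onto `ℝ` and decreases by at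
least `m` under the map `α`. -/
theorem exists_primitive_inv {q α : ℝ → ℝ} (hq : ContinuousOn q (Ici 0))
    (hq0 : ∀ r, 0 < r → 0 < q r) (hα : ∀ r, 0 < r → 0 < α r) {m : ℝ} (hm : 0 < m)
    (hmα : ∀ a, 0 < a → m ≤ ∫ s in (α a)..a, (q s)⁻¹)
    (hdiv : ¬ IntegrableOn (fun s => (q s)⁻¹) (Ici 1)) :
    ∃ Fn : ℝ → ℝ, (∀ r, 0 < r → HasDerivAt Fn (q r)⁻¹ r) ∧ StrictMonoOn Fn (Ioi 0) ∧
      SurjOn Fn (Ioi 0) univ ∧ ∀ a, 0 < a → Fn (α a) ≤ Fn a - m := by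
  have hc : ContinuousOn (fun s => (q s)⁻¹) (Ioi 0) :=
    (hq.mono Ioi_subset_Ici_self).inv₀ fun r hr => (hq0 r hr).ne'
  have hint : ∀ a b, 0 < a → 0 < b → IntervalIntegrable (fun s => (q s)⁻¹) volume a b :=
    fun a b ha hb => (hc.mono (ordConnected_Ioi.uIcc_subset ha hb)).intervalIntegrable
  have hFd : ∀ r, 0 < r → HasDerivAt (fun r => ∫ s in (1 : ℝ)..r, (q s)⁻¹) (q r)⁻¹ r := by
    intro r hr
    refine intervalIntegral.integral_hasDerivAt_right (hint _ _ one_pos hr) ?_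
      (hc.continuousAt (Ioi_mem_nhds hr))
    exact hc.stronglyMeasurableAtFilter isOpen_Ioi r hr
  have hFm : StrictMonoOn (fun r => ∫ s in (1 : ℝ)..r, (q s)⁻¹) (Ioi 0) := by
    refine strictMonoOn_of_deriv_pos (convex_Ioi 0)
      (fun r hr => (hFd r hr).continuousAt.continuousWithinAt) fun r hr => ?_
    rw [interior_Ioi] at hr
    rw [(hFd r hr).deriv]
    exact inv_pos.2 (hq0 r hr)
  have hFα : ∀ a, 0 < a → (∫ s in (1 : ℝ)..α a, (q s)⁻¹) ≤ (∫ s in (1 : ℝ)..a, (q s)⁻¹) - m := by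
    intro a ha
    have := intervalIntegral.integral_interval_sub_left (hint 1 a one_pos ha)
      (hint 1 (α a) one_pos (hα a ha))
    have := hmα a ha
    linarith
  refine ⟨fun r => ∫ s in (1 : ℝ)..r, (q s)⁻¹, hFd, hFm, fun y _ => ?_, hFα⟩
  have hlow : ∃ a, 0 < a ∧ (∫ s in (1 : ℝ)..a, (q s)⁻¹) ≤ y := by
    have hk : ∀ k : ℕ, 0 < α^[k] 1 ∧ (∫ s in (1 : ℝ)..α^[k] 1, (q s)⁻¹) ≤ -(k * m) := by
      intro k
      induction k with
      | zero => simp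
      | succ k ih =>
        rw [Function.iterate_succ_apply']
        refine ⟨hα _ ih.1, (hFα _ ih.1).trans ?_⟩
        push_cast
        linarith [ih.2]
    obtain ⟨k, hk'⟩ := exists_nat_ge (-y / m)
    refine ⟨_, (hk k).1, (hk k).2.trans ?_⟩
    rw [div_le_iff₀ hm] at hk'
    linarith
  have hhigh : ∃ b, 0 < b ∧ y ≤ ∫ s in (1 : ℝ)..b, (q s)⁻¹ := by
    by_contra! hcon
    refine hdiv ((integrableOn_Ici_iff_integrableOn_Ioi).2 ?_)
    refine integrableOn_Ioi_of_intervalIntegral_norm_bounded (b := fun i : ℝ => max 1 i)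
      (l := atTop) y 1 (fun i => ?_) (tendsto_atTop_mono (fun i => le_max_right _ _) tendsto_id) ?_
    · exact (hint 1 (max 1 i) one_pos (one_pos.trans_le (le_max_left _ _))).1
    · refine Eventually.of_forall fun i => ?_
      refine le_trans (le_of_eq ?_) (hcon (max 1 i) (one_pos.trans_le (le_max_left _ _))).le
      refine intervalIntegral.integral_congr fun s hs => ?_
      rw [uIcc_of_le (le_max_left _ _)] at hs
      exact Real.norm_of_nonneg (inv_pos.2 (hq0 s (one_pos.trans_le hs.1))).le
  obtain ⟨a, ha, hay⟩ := hlow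
  obtain ⟨b, hb, hyb⟩ := hhigh
  have hcF : ContinuousOn (fun r => ∫ s in (1 : ℝ)..r, (q s)⁻¹) (uIcc a b) := fun r hr =>
    (hFd r (ordConnected_Ioi.uIcc_subset ha hb hr)).continuousAt.continuousWithinAt
  obtain ⟨r, hr, hry⟩ := intermediate_value_uIcc hcF (mem_uIcc.2 (Or.inl ⟨hay, hyb⟩))
  exact ⟨r, ordConnected_Ioi.uIcc_subset ha hb hr, hry⟩

theorem ClassKInf.of_surjOn {α : ℝ → ℝ} (hm : StrictMonoOn α (Ici 0)) (h0 : α 0 = 0)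
    (hs : SurjOn α (Ici 0) (Ici 0)) : ClassKInf α := by
  refine ⟨?_, hm, h0, fun M => ?_⟩
  · have hmono : Monotone fun r => if r < 0 then r else α r := by
      intro a b hab
      have hpos : ∀ r, 0 ≤ r → 0 ≤ α r := fun r hr =>
        h0 ▸ hm.monotoneOn self_mem_Ici hr hr
      by_cases ha : a < 0 <;> by_cases hb : b < 0
      · simpa [ha, hb]
      · simpa [ha, hb] using ha.le.trans (hpos b (not_lt.1 hb))
      · exact absurd (hab.trans_lt hb) ha
      · simpa [ha, hb] using hm.monotoneOn (not_lt.1 ha) (not_lt.1 hb) hab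
    have hsurj : Function.Surjective fun r => if r < 0 then r else α r := by
      intro y
      by_cases hy : y < 0
      · exact ⟨y, by simp [hy]⟩
      · obtain ⟨r, hr, hry⟩ := hs (not_lt.1 hy)
        exact ⟨r, by simp [not_lt.2 (mem_Ici.1 hr), hry]⟩
    exact (hmono.continuous_of_surjective hsurj).continuousOn.congr fun r hr => by
      simp [not_lt.2 (mem_Ici.1 hr)]
  · obtain ⟨r, hr, hrM⟩ := hs (le_max_right M 0)
    exact ⟨r, hr, hrM ▸ le_max_left _ _⟩

theorem ClassKInf.nonneg {α : ℝ → ℝ} (h : ClassKInf α) {r : ℝ} (hr : 0 ≤ r) : 0 ≤ α r :=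
  h.2.2.1 ▸ h.2.1.monotoneOn self_mem_Ici hr hr

theorem ClassKInf.surjOn {α : ℝ → ℝ} (h : ClassKInf α) : SurjOn α (Ici 0) (Ici 0) := by
  intro y hy
  obtain ⟨b, hb, hyb⟩ := h.2.2.2 y
  obtain ⟨r, hr, hry⟩ := intermediate_value_Icc hb (h.1.mono Icc_subset_Ici_self)
    ⟨h.2.2.1.symm ▸ hy, hyb⟩
  exact ⟨r, hr.1, hry⟩

theorem ClassKInf.comp {α β : ℝ → ℝ} (hα : ClassKInf α) (hβ : ClassKInf β) :
    ClassKInf fun r => α (β r) := by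
  refine .of_surjOn (hα.2.1.comp hβ.2.1 fun r hr => hβ.nonneg hr) ?_ ?_
  · simp [hβ.2.2.1, hα.2.2.1]
  · exact hα.surjOn.comp hβ.surjOn

theorem ClassKInf.add {α β : ℝ → ℝ} (hα : ClassKInf α) (hβ : ClassKInf β) :
    ClassKInf fun r => α r + β r := by
  refine ⟨hα.1.add hβ.1, hα.2.1.add hβ.2.1, by simp [hβ.2.2.1, hα.2.2.1], fun M => ?_⟩
  obtain ⟨r, hr, hM⟩ := hα.2.2.2 M
  exact ⟨r, hr, by linarith [hβ.nonneg hr]⟩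

theorem ClassKInf.exists_inverse {α : ℝ → ℝ} (h : ClassKInf α) :
    ∃ αi : ℝ → ℝ, ClassKInf αi ∧ ∀ r, 0 ≤ r → αi (α r) = r := by
  have hex : ∀ y, 0 ≤ y → ∃ r, 0 ≤ r ∧ α r = y := fun y hy => h.surjOn hy
  choose! αi h0 hi using hex
  have hinv : ∀ r : ℝ, 0 ≤ r → αi (α r) = r := fun r hr =>
    h.2.1.injOn (h0 _ (h.nonneg hr)) hr (hi _ (h.nonneg hr))
  refine ⟨αi, .of_surjOn (fun a ha b hb hab => ?_) ?_ fun r hr => ?_, hinv⟩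
  · rw [← h.2.1.lt_iff_lt (h0 a ha) (h0 b hb), hi a ha, hi b hb]
    exact hab
  · simpa [h.2.2.1] using hinv 0 le_rfl
  · exact ⟨α r, h.nonneg hr, hinv r hr⟩

/-- `shiftAlong Fn r a` is the point of `(0,∞)` whose `Fn`-value exceeds that of `r` by `a`,
extended by zero. -/
def shiftAlong (Fn : ℝ → ℝ) (r a : ℝ) : ℝ :=
  if r ≤ 0 then 0 else Function.invFunOn Fn (Ioi 0) (Fn r + a)

theorem shiftAlong_spec {Fn : ℝ → ℝ} (hs : SurjOn Fn (Ioi 0) univ) {r : ℝ} (hr : 0 < r) (a : ℝ) :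
    0 < shiftAlong Fn r a ∧ Fn (shiftAlong Fn r a) = Fn r + a := by
  have := hs (mem_univ (Fn r + a))
  rw [shiftAlong, if_neg (not_le.2 hr)]
  exact ⟨Function.invFunOn_mem this, Function.invFunOn_eq this⟩

theorem le_shiftAlong {Fn : ℝ → ℝ} (hm : StrictMonoOn Fn (Ioi 0)) (hs : SurjOn Fn (Ioi 0) univ)
    {r a w : ℝ} (hr : 0 < r) (h : 0 < w → Fn w ≤ Fn r + a) : w ≤ shiftAlong Fn r a := by
  obtain ⟨h0, h1⟩ := shiftAlong_spec hs hr a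
  rcases le_or_gt w 0 with hw | hw
  · exact hw.trans h0.le
  · exact (hm.le_iff_le hw h0).1 (h1 ▸ h hw)

theorem shiftAlong_nonneg {Fn : ℝ → ℝ} (hs : SurjOn Fn (Ioi 0) univ) (r a : ℝ) :
    0 ≤ shiftAlong Fn r a := by
  rcases le_or_gt r 0 with hr | hr
  · simp [shiftAlong, hr]
  · exact (shiftAlong_spec hs hr a).1.le

theorem shiftAlong_mono_right {Fn : ℝ → ℝ} (hm : StrictMonoOn Fn (Ioi 0))
    (hs : SurjOn Fn (Ioi 0) univ) (r : ℝ) : Monotone (shiftAlong Fn r) := by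
  intro a b hab
  rcases le_or_gt r 0 with hr | hr
  · simp [shiftAlong, hr]
  · refine le_shiftAlong hm hs hr fun _ => ?_
    rw [(shiftAlong_spec hs hr a).2]
    linarith

theorem shiftAlong_classKInf {Fn : ℝ → ℝ} (hm : StrictMonoOn Fn (Ioi 0))
    (hs : SurjOn Fn (Ioi 0) univ) (a : ℝ) : ClassKInf fun r => shiftAlong Fn r a := by
  have h0 : shiftAlong Fn 0 a = 0 := by simp [shiftAlong]
  refine .of_surjOn (fun r hr r' hr' hrr => ?_) h0 fun y hy => ?_
  · have hr'0 : 0 < r' := lt_of_le_of_lt hr hrr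
    obtain ⟨h1, h2⟩ := shiftAlong_spec hs hr'0 a
    rcases (mem_Ici.1 hr).eq_or_lt with rfl | hr0
    · simpa [h0] using h1
    · obtain ⟨h3, h4⟩ := shiftAlong_spec hs hr0 a
      refine (hm.lt_iff_lt h3 h1).1 ?_
      rw [h2, h4]
      linarith [hm hr0 hr'0 hrr]
  · rcases (mem_Ici.1 hy).eq_or_lt with rfl | hy0
    · exact ⟨0, self_mem_Ici, h0⟩
    · obtain ⟨r, hr, hry⟩ := hs (mem_univ (Fn y - a))
      obtain ⟨h1, h2⟩ := shiftAlong_spec hs hr a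
      exact ⟨r, (mem_Ioi.1 hr).le, hm.injOn h1 hy0 (by rw [h2, hry]; ring)⟩

theorem tendsto_shiftAlong_atBot {Fn : ℝ → ℝ} (hm : StrictMonoOn Fn (Ioi 0))
    (hs : SurjOn Fn (Ioi 0) univ) (r : ℝ) :
    Tendsto (shiftAlong Fn r) atBot (nhds 0) := by
  rw [Metric.tendsto_nhds]
  intro ε hε
  rcases le_or_gt r 0 with hr | hr
  · simp [shiftAlong, hr, hε]
  · filter_upwards [eventually_lt_atBot (Fn ε - Fn r)] with a ha
    obtain ⟨h1, h2⟩ := shiftAlong_spec hs hr a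
    rw [Real.dist_eq, sub_zero, abs_of_pos h1]
    exact (hm.lt_iff_lt h1 hε).1 (by linarith)

theorem inputNorm_nonneg {m : ℕ} (γ : Set ℝ) (u : ℝ → Stt m) (I : Set ℝ) :
    0 ≤ inputNorm γ u I := by
  refine le_max_of_le_right (Real.sSup_nonneg ?_)
  rintro _ ⟨t, -, rfl⟩
  exact norm_nonneg _

theorem norm_le_inputNorm {m : ℕ} {γ : Set ℝ} (hγ : IsImpulseSeq γ) (u : ℝ → Stt m)
    {t0 t τ : ℝ} (hτ : τ ∈ γ) (h0 : t0 < τ) (h1 : τ ≤ t) :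
    ‖u τ‖ ≤ inputNorm γ u (Ioc t0 t) := by
  refine le_max_of_le_right (le_csSup ?_ (mem_image_of_mem _ ⟨hτ, h0, h1⟩))
  exact (((hγ.2 t).subset (inter_subset_inter_right _ fun s hs => hs.2)).image _).bddAbove

theorem ae_norm_le_inputNorm {m : ℕ} (γ : Set ℝ) {u : ℝ → Stt m} (hu : IsInput u)
    {t0 t : ℝ} (h0 : 0 ≤ t0) :
    ∀ᵐ s, s ∈ Ioc t0 t → ‖u s‖ ≤ inputNorm γ u (Ioc t0 t) := by
  obtain ⟨C, hC⟩ := hu.2 t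
  have hb : IsBoundedUnder (· ≤ ·) (ae (volume.restrict (Ioc t0 t))) fun s => ‖u s‖ := by
    refine ⟨C, ?_⟩
    rw [eventually_map]
    refine (ae_restrict_iff' measurableSet_Ioc).2 ?_
    filter_upwards [hC] with s hs hsI using hs ⟨h0.trans hsI.1.le, hsI.2⟩
  have := (ae_restrict_iff' measurableSet_Ioc).1 (ae_le_essSup hb)
  filter_upwards [this] with s hs hsI using le_max_of_le_left (hs hsI)

theorem IsImpulseSeq.exists_next {γ : Set ℝ} (hγ : IsImpulseSeq γ) {θ : ℝ}
    (h : (∃ s ∈ γ, s ≤ θ) ∧ ∀ s ∈ γ, ∃ t ∈ γ, s < t ∧ t ≤ s + θ) {σ : ℝ} (hσ : 0 ≤ σ) :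
    ∃ τ ∈ γ, σ < τ ∧ τ ≤ σ + θ := by
  rcases (γ ∩ Iic σ).eq_empty_or_nonempty with he | hne
  · obtain ⟨s, hs, hsθ⟩ := h.1
    refine ⟨s, hs, ?_, by linarith⟩
    by_contra! hc
    exact (he ▸ (⟨hs, hc⟩ : s ∈ γ ∩ Iic σ) : s ∈ (∅ : Set ℝ))
  · obtain ⟨s, hs, hmax⟩ := (hγ.2 σ).isCompact.exists_isGreatest hne
    obtain ⟨t, ht, hst, htθ⟩ := h.2 s hs.1
    refine ⟨t, ht, ?_, htθ.trans (by linarith [mem_Iic.1 hs.2])⟩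
    by_contra! hc
    exact absurd (hmax ⟨ht, hc⟩) (not_le.2 hst)

theorem IsImpulseSeq.exists_gap_right {γ : Set ℝ} (hγ : IsImpulseSeq γ) (σ : ℝ) :
    ∃ b, σ < b ∧ Ioo σ b ∩ γ = ∅ := by
  rcases (γ ∩ Ioc σ (σ + 1)).eq_empty_or_nonempty with he | hne
  · refine ⟨σ + 1, by linarith, eq_empty_of_forall_notMem fun s hs => ?_⟩
    exact (he ▸ (⟨hs.2, hs.1.1, hs.1.2.le⟩ : s ∈ γ ∩ Ioc σ (σ + 1)) : s ∈ (∅ : Set ℝ))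
  · obtain ⟨τ, hτ, hmin⟩ := ((hγ.2 (σ + 1)).subset
      (inter_subset_inter_right γ fun s (hs : s ∈ Ioc σ (σ + 1)) => hs.2)).isCompact
    |>.exists_isLeast hne
    refine ⟨τ, hτ.2.1, eq_empty_of_forall_notMem fun s hs => ?_⟩
    exact absurd (hmin ⟨hs.2, hs.1.1, hs.1.2.le.trans hτ.2.2⟩) (not_le.2 hs.1.2)

/-- Just before an impulse time `σ` after `t0` the number of impulses since `t0` is one less. -/
theorem IsImpulseSeq.exists_before {γ : Set ℝ} (hγ : IsImpulseSeq γ) {t0 σ : ℝ} (hσ : σ ∈ γ)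
    (h : t0 < σ) : ∃ s, t0 ≤ s ∧ s < σ ∧ Ioo s σ ∩ γ = ∅ ∧ nJumps γ t0 σ = nJumps γ t0 s + 1 := by
  have hfin : (insert t0 (γ ∩ Ioo t0 σ)).Finite :=
    ((hγ.2 σ).subset (inter_subset_inter_right γ fun s (hs : s ∈ Ioo t0 σ) => hs.2.le)).insert t0
  obtain ⟨s, hs, hmax⟩ := hfin.isCompact.exists_isGreatest (insert_nonempty _ _)
  have h1 : t0 ≤ s := hmax (mem_insert _ _)
  have h2 : s < σ := by
    rcases hs with rfl | hs
    · exact h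
    · exact hs.2.2
  have h3 : ∀ r ∈ γ, t0 < r → r < σ → r ≤ s := fun r hr hr0 hrσ =>
    hmax (mem_insert_of_mem _ ⟨hr, hr0, hrσ⟩)
  refine ⟨s, h1, h2, eq_empty_of_forall_notMem fun r hr => ?_, ?_⟩
  · exact absurd (h3 r hr.2 (h1.trans_lt hr.1.1) hr.1.2) (not_le.2 hr.1.1)
  · have he : γ ∩ Ioc t0 σ = insert σ (γ ∩ Ioc t0 s) := by
      ext r
      constructor
      · rintro ⟨hr, hr0, hr1⟩
        rcases hr1.eq_or_lt with rfl | hlt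
        · exact mem_insert _ _
        · exact mem_insert_of_mem _ ⟨hr, hr0, h3 r hr hr0 hlt⟩
      · rintro (rfl | hr)
        · exact ⟨hσ, h, le_rfl⟩
        · exact ⟨hr.1, hr.2.1, hr.2.2.trans h2.le⟩
    rw [nJumps, he, ncard_insert_of_notMem (fun hc => absurd hc.2.2 (not_le.2 h2))
      ((hγ.2 s).subset (inter_subset_inter_right γ fun s hs => hs.2))]
    rfl


/-- Along the flow the primitive of `1 / q` grows at most by the integral of `p`, as long as the
Lyapunov function exceeds the level `R` dominating the input. -/
theorem IsSolution.primitive_flow_le {n m : ℕ} {γ : Set ℝ} {f g : ℝ → Stt n → Stt m → Stt n}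
    {t0 : ℝ} {x0 : Stt n} {u : ℝ → Stt m} {T : EReal} {x : ℝ → Stt n}
    (hx : IsSolution γ f g t0 x0 u T x) (hγ : IsImpulseSeq γ) {V Vm : ℝ → Stt n → ℝ}
    (hV : InClassV γ V Vm) {p q Fn χ : ℝ → ℝ} (hχ : ClassKInf χ)
    (hdini : ∀ (t : ℝ) (ξ : Stt n) (μ : Stt m), 0 ≤ t → t ∉ γ → χ ‖μ‖ ≤ V t ξ →
      DiniAlong f V t ξ μ ≤ p t * q (V t ξ))
    (hq : ContinuousOn q (Ici 0)) (hq0 : ∀ r, 0 < r → 0 < q r)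
    (hFd : ∀ r, 0 < r → HasDerivAt Fn (q r)⁻¹ r) (hFm : StrictMonoOn Fn (Ioi 0))
    (hp : LocIntegrable p) (hp0 : ∀ t, 0 ≤ t → 0 ≤ p t) {U R t : ℝ} (hR : 0 < R)
    (hU : 0 ≤ U) (hχR : χ U ≤ R) (hu : ∀ᵐ s, s ∈ Ioc t0 t → ‖u s‖ ≤ U) (ht0 : 0 ≤ t0)
    {σ s : ℝ} (hσ : t0 ≤ σ) (hσs : σ ≤ s) (hst : s ≤ t) (hsT : (s : EReal) < T)
    (hgap : Ioc σ s ∩ γ = ∅) :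
    Fn (max (V s (x s)) R) ≤ Fn (max (V σ (x σ)) R) + ∫ r in σ..s, p r := by
  obtain ⟨b, hsb, hb⟩ := hγ.exists_gap_right s
  have hgap' : Ioo σ b ∩ γ = ∅ := by
    refine eq_empty_of_forall_notMem fun r hr => ?_
    rcases le_or_gt r s with hrs | hrs
    · exact (hgap ▸ (⟨⟨hr.1.1, hrs⟩, hr.2⟩ : r ∈ Ioc σ s ∩ γ) : r ∈ (∅ : Set ℝ))
    · exact (hb ▸ (⟨⟨hrs, hr.1.2⟩, hr.2⟩ : r ∈ Ioo s b ∩ γ) : r ∈ (∅ : Set ℝ))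
  have hσ0 : 0 ≤ σ := ht0.trans hσ
  obtain ⟨hac, hder⟩ := (hV.1 σ b hσ0 hgap').along_curve (x := x) le_rfl hσs hsb
    (hx.flow σ s hσ hσs hsT hgap).1 fun r hr =>
      (hx.flow σ r hσ hr.1 (lt_of_le_of_lt (EReal.coe_le_coe_iff.2 hr.2) hsT)
        (subset_empty_iff.1 (hgap ▸ inter_subset_inter_left _ (Ioc_subset_Ioc_right hr.2)))).2
  refine primitive_max_le_add_integral hσs hR hac hq hq0 hFd hFm (hp σ s)
    (fun r hr => hp0 r (hσ0.trans hr.1)) ?_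
  filter_upwards [hder, hu] with r hr hur hrI hRr
  obtain ⟨w, hw, hwl⟩ := hr hrI
  refine ⟨w, hw, ?_⟩
  rw [← hwl]
  refine hdini r (x r) (u r) (hσ0.trans hrI.1.le) (fun hrγ => ?_) ?_
  · exact (hgap ▸ (⟨⟨hrI.1, hrI.2.le⟩, hrγ⟩ : r ∈ Ioc σ s ∩ γ) : r ∈ (∅ : Set ℝ))
  · have h1 : ‖u r‖ ≤ U := hur ⟨hσ.trans_lt hrI.1, hrI.2.le.trans hst⟩
    exact (hχ.2.1.monotoneOn (norm_nonneg _) hU h1).trans (hχR.trans hRr.le)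

/-- Across an impulse the primitive decreases by `m`, unless it drops to the level `R`. -/
theorem IsSolution.primitive_jump_le {n m : ℕ} {γ : Set ℝ} {f g : ℝ → Stt n → Stt m → Stt n}
    {t0 : ℝ} {x0 : Stt n} {u : ℝ → Stt m} {T : EReal} {x : ℝ → Stt n}
    (hx : IsSolution γ f g t0 x0 u T x) {V Vm : ℝ → Stt n → ℝ}
    (hV : InClassV γ V Vm) {Fn χ π α : ℝ → ℝ} (hχ : ClassKInf χ) (hπ : ClassKInf π)
    (hα0 : ∀ r, 0 < r → 0 < α r)
    (hj1 : ∀ (t : ℝ) (ξ : Stt n) (μ : Stt m), t ∈ γ → χ ‖μ‖ ≤ Vm t ξ →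
      V t (ξ + g t ξ μ) ≤ α (Vm t ξ))
    (hj2 : ∀ (t : ℝ) (ξ : Stt n) (μ : Stt m), t ∈ γ → Vm t ξ ≤ χ ‖μ‖ →
      V t (ξ + g t ξ μ) ≤ π ‖μ‖)
    (hFc : ∀ r, 0 < r → ContinuousAt Fn r) (hFm : StrictMonoOn Fn (Ioi 0)) {d : ℝ}
    (hFα : ∀ a, 0 < a → Fn (α a) ≤ Fn a - d)
    {U R K τ s : ℝ} (hR : 0 < R) (hU : 0 ≤ U) (hπR : π U ≤ R) (hτ : τ ∈ γ) (hu : ‖u τ‖ ≤ U)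
    (h0τ : t0 < τ) (hsτ : s < τ) (hτT : (τ : EReal) < T)
    (hK : ∀ r, s ≤ r → r < τ → Fn (max (V r (x r)) R) ≤ K) :
    Fn (max (V τ (x τ)) R) ≤ max (Fn R) (K - d) := by
  obtain ⟨L, hL, hxL⟩ := hx.jump τ hτ h0τ hτT
  have hVL : Tendsto (fun r => V r (x r)) (nhdsWithin τ (Iio τ)) (nhds (Vm τ L)) := by
    refine (hV.2 τ hτ L).comp (f := fun r => (r, x r)) ?_
    rw [nhdsWithin_prod_eq, nhdsWithin_univ]
    exact tendsto_id.prodMk hL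
  have hKL : Fn (max (Vm τ L) R) ≤ K := by
    have hc : ContinuousAt Fn (max (Vm τ L) R) := hFc _ (lt_max_of_lt_right hR)
    refine le_of_tendsto (hc.tendsto.comp (hVL.max tendsto_const_nhds)) ?_
    filter_upwards [Ico_mem_nhdsLT hsτ] with r hr using hK r hr.1 hr.2
  have hR' : V τ (x τ) ≤ R → Fn (max (V τ (x τ)) R) ≤ max (Fn R) (K - d) := fun h => by
    rw [max_eq_right h]
    exact le_max_left _ _
  rcases le_or_gt (Vm τ L) (χ ‖u τ‖) with hle | hlt
  · refine hR' ?_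
    rw [hxL]
    exact (hj2 τ L (u τ) hτ hle).trans ((hπ.2.1.monotoneOn (norm_nonneg _) hU hu).trans hπR)
  · rcases le_or_gt (V τ (x τ)) R with h | h
    · exact hR' h
    · have hpos : 0 < Vm τ L := (hχ.nonneg (norm_nonneg _)).trans_lt hlt
      have h1 : V τ (x τ) ≤ α (Vm τ L) := hxL ▸ hj1 τ L (u τ) hτ hlt.le
      have h2 : Fn (V τ (x τ)) ≤ Fn (α (Vm τ L)) :=
        hFm.monotoneOn (hR.trans h) (hα0 _ hpos) h1
      have h3 : Fn (Vm τ L) ≤ Fn (max (Vm τ L) R) :=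
        hFm.monotoneOn hpos (lt_max_of_lt_right hR) (le_max_left _ _)
      rw [max_eq_left h.le]
      exact le_max_of_le_right (by linarith [hFα _ hpos])

theorem IsImpulseSeq.exists_last {γ : Set ℝ} (hγ : IsImpulseSeq γ) {t0 t : ℝ}
    (h : nJumps γ t0 t ≠ 0) :
    ∃ σ ∈ γ, t0 < σ ∧ σ ≤ t ∧ Ioc σ t ∩ γ = ∅ ∧ nJumps γ t0 σ = nJumps γ t0 t := by
  have hfin : (γ ∩ Ioc t0 t).Finite :=
    (hγ.2 t).subset (inter_subset_inter_right γ fun s hs => hs.2)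
  obtain ⟨σ, hσ, hmax⟩ := hfin.isCompact.exists_isGreatest (nonempty_of_ncard_ne_zero h)
  refine ⟨σ, hσ.1, hσ.2.1, hσ.2.2, eq_empty_of_forall_notMem fun r hr => ?_, ?_⟩
  · exact absurd (hmax ⟨hr.2, hσ.2.1.trans hr.1.1, hr.1.2⟩) (not_le.2 hr.1.1)
  · refine congrArg ncard (Subset.antisymm ?_ ?_)
    · exact inter_subset_inter_right _ (Ioc_subset_Ioc_right hσ.2.2)
    · exact fun r hr => ⟨hr.1, hr.2.1, hmax hr⟩

/-- If a quantity `Z` grows by at most `M` between impulses and decreases by `d` at impulses until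
it is below the level `B`, then `k` impulses decrease it by `k * (d - M)`. -/
theorem IsImpulseSeq.le_of_flow_of_jump {γ : Set ℝ} (hγ : IsImpulseSeq γ) {θ : ℝ}
    (hθ : (∃ s ∈ γ, s ≤ θ) ∧ ∀ s ∈ γ, ∃ t ∈ γ, s < t ∧ t ≤ s + θ) {t0 t B M d : ℝ}
    (ht0 : 0 ≤ t0) (hMd : M ≤ d) {Z : ℝ → ℝ}
    (hflow : ∀ σ s, t0 ≤ σ → σ ≤ s → s ≤ t → Ioc σ s ∩ γ = ∅ → Z s ≤ Z σ + M)
    (hjump : ∀ τ s K, τ ∈ γ → t0 ≤ s → s < τ → τ ≤ t → (∀ r, s ≤ r → r < τ → Z r ≤ K) →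
      Z τ ≤ max B (K - d)) (k : ℕ) :
    ∀ s, t0 ≤ s → s ≤ t → nJumps γ t0 s = k →
      ∃ σ, t0 ≤ σ ∧ σ ≤ s ∧ Ioc σ s ∩ γ = ∅ ∧ Z σ ≤ max B (Z t0 - k * (d - M)) ∧
        σ - t0 ≤ k * θ := by
  induction k with
  | zero =>
    intro s hs hst hk
    refine ⟨t0, le_rfl, hs, ?_, by simp, by simp⟩
    rw [inter_comm]
    exact (ncard_eq_zero ((hγ.2 s).subset (inter_subset_inter_right γ fun s hs => hs.2))).1 hk
  | succ k ih =>
    intro s hs hst hk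
    obtain ⟨σ, hσ, h0σ, hσs, hgap, hnσ⟩ := hγ.exists_last (by omega : nJumps γ t0 s ≠ 0)
    obtain ⟨r, h0r, hrσ, hrgap, hnr⟩ := hγ.exists_before hσ h0σ
    obtain ⟨ρ, h0ρ, hρr, hρgap, hZρ, hρk⟩ := ih r h0r (hrσ.le.trans (hσs.trans hst)) (by omega)
    have hρσ : Ioo ρ σ ∩ γ = ∅ := by
      refine eq_empty_of_forall_notMem fun v hv => ?_
      rcases le_or_gt v r with hvr | hvr
      · exact (hρgap ▸ (⟨⟨hv.1.1, hvr⟩, hv.2⟩ : v ∈ Ioc ρ r ∩ γ) : v ∈ (∅ : Set ℝ))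
      · exact (hrgap ▸ (⟨⟨hvr, hv.1.2⟩, hv.2⟩ : v ∈ Ioo r σ ∩ γ) : v ∈ (∅ : Set ℝ))
    refine ⟨σ, h0σ.le, hσs, hgap, ?_, ?_⟩
    · refine (hjump σ ρ (Z ρ + M) hσ h0ρ (hρr.trans_lt hrσ) (hσs.trans hst)
        fun v hv hvσ => hflow ρ v h0ρ hv (hvσ.le.trans (hσs.trans hst)) ?_).trans ?_
      · exact subset_empty_iff.1 (hρσ ▸ inter_subset_inter_left _
          fun w hw => ⟨hw.1, hw.2.trans_lt hvσ⟩)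
      · refine max_le (le_max_left _ _) ?_
        push_cast
        rcases max_cases B (Z t0 - k * (d - M)) with ⟨he, -⟩ | ⟨he, -⟩
        · exact le_max_of_le_left (by linarith)
        · exact le_max_of_le_right (by linarith)
    · obtain ⟨τ, hτ, hρτ, hτθ⟩ := hγ.exists_next hθ (ht0.trans h0ρ)
      have : σ ≤ τ := by
        by_contra! hc
        exact (hρσ ▸ (⟨⟨hρτ, hc⟩, hτ⟩ : τ ∈ Ioo ρ σ ∩ γ) : τ ∈ (∅ : Set ℝ))
      push_cast
      linarith

theorem ClassKInf.le_of_forall_gt {α : ℝ → ℝ} (h : ClassKInf α) {r w c : ℝ} (hr : 0 ≤ r)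
    (hw : ∀ s, r < s → w ≤ max (α s) c) : w ≤ max (α r) c := by
  have hc : Tendsto α (nhdsWithin r (Ioi r)) (nhds (α r)) :=
    (h.1 r hr).mono_left (nhdsWithin_mono _ fun s hs => hr.trans (mem_Ioi.1 hs).le)
  refine ge_of_tendsto (hc.max tendsto_const_nhds) ?_
  filter_upwards [self_mem_nhdsWithin] with s hs using hw s hs

theorem le_max_shiftAlong {Fn : ℝ → ℝ} (hm : StrictMonoOn Fn (Ioi 0))
    (hs : SurjOn Fn (Ioi 0) univ) {R w z M e : ℝ} (hR : 0 < R)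
    (h : Fn (max w R) ≤ max (Fn R) (Fn (max z R) - e) + M) (he : 0 ≤ e) :
    w ≤ max (shiftAlong Fn R M) (shiftAlong Fn z (M - e)) := by
  have hw : 0 < w → Fn w ≤ Fn (max w R) := fun hw =>
    hm.monotoneOn hw (lt_max_of_lt_right hR) (le_max_left _ _)
  rcases le_or_gt (Fn (max z R) - e) (Fn R) with hle | hlt
  · rw [max_eq_left hle] at h
    exact le_max_of_le_left (le_shiftAlong hm hs hR fun h0 => (hw h0).trans h)
  · have hzR : R < z := by
      by_contra! hc
      rw [max_eq_right hc] at hlt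
      linarith
    rw [max_eq_right hlt.le, max_eq_left hzR.le] at h
    exact le_max_of_le_right
      (le_shiftAlong hm hs (hR.trans hzR) fun h0 => by linarith [hw h0])

theorem ClassKInf.classKL_shiftAlong {ψ φ Fn : ℝ → ℝ} (hψ : ClassKInf ψ) (hφ : ClassKInf φ)
    (hm : StrictMonoOn Fn (Ioi 0)) (hs : SurjOn Fn (Ioi 0) univ) (a : ℝ) {c : ℝ} (hc : 0 < c) :
    ClassKL fun r t => ψ (shiftAlong Fn (φ r) (a - c * t)) := by
  refine ⟨fun t _ => hψ.comp ((shiftAlong_classKInf hm hs _).comp hφ), fun r _ => ⟨?_, ?_⟩⟩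
  · intro t _ t' _ htt
    refine hψ.2.1.monotoneOn (shiftAlong_nonneg hs _ _) (shiftAlong_nonneg hs _ _)
      (shiftAlong_mono_right hm hs _ ?_)
    have := mul_le_mul_of_nonneg_left htt hc.le
    linarith
  · have h1 : Tendsto (fun t : ℝ => a - c * t) atTop atBot :=
      tendsto_atBot_add_const_left _ a (tendsto_neg_atTop_atBot.comp (tendsto_id.const_mul_atTop hc))
    have h2 : Tendsto (fun t => shiftAlong Fn (φ r) (a - c * t)) atTop
        (nhdsWithin 0 (Ici 0)) :=
      tendsto_nhdsWithin_iff.2 ⟨(tendsto_shiftAlong_atBot hm hs (φ r)).comp h1,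
        .of_forall fun t => shiftAlong_nonneg hs _ _⟩
    have h3 := (hψ.1 0 self_mem_Ici).tendsto.comp h2
    rwa [hψ.2.2.1] at h3

/-- The impulse-count bound for the Lyapunov function along a solution. -/
theorem IsSolution.lyapunov_le {n m : ℕ} {γ : Set ℝ} {f g : ℝ → Stt n → Stt m → Stt n}
    {t0 : ℝ} {x0 : Stt n} {u : ℝ → Stt m} {T : EReal} {x : ℝ → Stt n}
    (hx : IsSolution γ f g t0 x0 u T x) (hγ : IsImpulseSeq γ) {V Vm : ℝ → Stt n → ℝ}
    (hV : InClassV γ V Vm) {p q Fn χ π α : ℝ → ℝ} (hχ : ClassKInf χ) (hπ : ClassKInf π)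
    (hα0 : ∀ r, 0 < r → 0 < α r)
    (hdini : ∀ (t : ℝ) (ξ : Stt n) (μ : Stt m), 0 ≤ t → t ∉ γ → χ ‖μ‖ ≤ V t ξ →
      DiniAlong f V t ξ μ ≤ p t * q (V t ξ))
    (hj1 : ∀ (t : ℝ) (ξ : Stt n) (μ : Stt m), t ∈ γ → χ ‖μ‖ ≤ Vm t ξ →
      V t (ξ + g t ξ μ) ≤ α (Vm t ξ))
    (hj2 : ∀ (t : ℝ) (ξ : Stt n) (μ : Stt m), t ∈ γ → Vm t ξ ≤ χ ‖μ‖ →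
      V t (ξ + g t ξ μ) ≤ π ‖μ‖)
    (hq : ContinuousOn q (Ici 0)) (hq0 : ∀ r, 0 < r → 0 < q r)
    (hFd : ∀ r, 0 < r → HasDerivAt Fn (q r)⁻¹ r) (hFm : StrictMonoOn Fn (Ioi 0))
    (hFs : SurjOn Fn (Ioi 0) univ) {M d : ℝ} (hFα : ∀ a, 0 < a → Fn (α a) ≤ Fn a - d)
    (hp : LocIntegrable p) (hp0 : ∀ t, 0 ≤ t → 0 ≤ p t) {θ : ℝ}
    (hθ : (∃ s ∈ γ, s ≤ θ) ∧ ∀ s ∈ γ, ∃ t ∈ γ, s < t ∧ t ≤ s + θ)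
    (hpM : ∀ t, 0 ≤ t → ∫ s in t..(t + θ), p s ≤ M) (hMd : M ≤ d)
    (hu : IsInput u) (ht0 : 0 ≤ t0) {t : ℝ} (ht : t0 ≤ t) (htT : (t : EReal) < T) :
    V t (x t) ≤ max
      (shiftAlong Fn (χ (inputNorm γ u (Ioc t0 t)) + π (inputNorm γ u (Ioc t0 t))) M)
      (shiftAlong Fn (V t0 x0) (M - nJumps γ t0 t * (d - M))) ∧
    t - t0 ≤ (nJumps γ t0 t + 1) * θ := by
  set U := inputNorm γ u (Ioc t0 t) with hUdef
  have hU : 0 ≤ U := inputNorm_nonneg _ _ _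
  have hgapθ : ∀ σ s, t0 ≤ σ → Ioc σ s ∩ γ = ∅ → s ≤ σ + θ := by
    intro σ s hσ hgap
    obtain ⟨τ, hτ, hστ, hτθ⟩ := hγ.exists_next hθ (ht0.trans hσ)
    by_contra! hc
    exact (hgap ▸ (⟨⟨hστ, hτθ.trans hc.le⟩, hτ⟩ : τ ∈ Ioc σ s ∩ γ) : τ ∈ (∅ : Set ℝ))
  have hint : ∀ σ s, t0 ≤ σ → σ ≤ s → Ioc σ s ∩ γ = ∅ → ∫ r in σ..s, p r ≤ M := by
    intro σ s hσ hσs hgap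
    have hs := hgapθ σ s hσ hgap
    have h0 : 0 ≤ σ := ht0.trans hσ
    refine le_trans ?_ (hpM σ h0)
    refine intervalIntegral.integral_mono_interval le_rfl hσs hs ?_ ?_
    · refine (ae_restrict_iff' measurableSet_Ioc).2 (.of_forall fun r hr => hp0 r ?_)
      exact h0.trans hr.1.le
    · exact (intervalIntegrable_iff_integrableOn_Icc_of_le (hσs.trans hs)).2 (hp _ _)
  have key : ∀ R, 0 < R → χ U ≤ R → π U ≤ R → ∃ σ, t0 ≤ σ ∧ σ ≤ t ∧ Ioc σ t ∩ γ = ∅ ∧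
      Fn (max (V t (x t)) R) ≤ max (Fn R)
        (Fn (max (V t0 x0) R) - nJumps γ t0 t * (d - M)) + M ∧
      σ - t0 ≤ nJumps γ t0 t * θ := by
    intro R hR hχR hπR
    have hflow : ∀ σ s, t0 ≤ σ → σ ≤ s → s ≤ t → Ioc σ s ∩ γ = ∅ →
        Fn (max (V s (x s)) R) ≤ Fn (max (V σ (x σ)) R) + M := fun σ s hσ hσs hst hgap =>
      (hx.primitive_flow_le hγ hV hχ hdini hq hq0 hFd hFm hp hp0 hR hU hχR
        (ae_norm_le_inputNorm γ hu ht0) ht0 hσ hσs hst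
        (lt_of_le_of_lt (EReal.coe_le_coe_iff.2 hst) htT) hgap).trans
        (by linarith [hint σ s hσ hσs hgap])
    obtain ⟨σ, h0σ, hσt, hgap, hZ, hσk⟩ := hγ.le_of_flow_of_jump hθ ht0 hMd
      (Z := fun s => Fn (max (V s (x s)) R)) (B := Fn R) hflow
      (fun τ s K hτ hs hsτ hτt hK => hx.primitive_jump_le hV hχ hπ hα0 hj1 hj2
        (fun r hr => (hFd r hr).continuousAt) hFm hFα hR hU hπR hτ
        (norm_le_inputNorm hγ u hτ (hs.trans_lt hsτ) hτt) (hs.trans_lt hsτ) hsτ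
        (lt_of_le_of_lt (EReal.coe_le_coe_iff.2 hτt) htT) hK) _ t ht le_rfl rfl
    rw [hx.init] at hZ
    exact ⟨σ, h0σ, hσt, hgap, (hflow σ t h0σ hσt le_rfl hgap).trans (by linarith), hσk⟩
  have hχU := hχ.nonneg hU
  have hπU := hπ.nonneg hU
  constructor
  · refine (shiftAlong_classKInf hFm hFs M).le_of_forall_gt (add_nonneg hχU hπU) fun R hR => ?_
    obtain ⟨σ, -, -, -, hF, -⟩ := key R (by linarith) (by linarith) (by linarith)
    exact le_max_shiftAlong hFm hFs (by linarith) hF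
      (mul_nonneg (Nat.cast_nonneg _) (by linarith))
  · obtain ⟨σ, h0σ, -, hgap, -, hσ⟩ := key (χ U + π U + 1) (by linarith) (by linarith) (by linarith)
    have := hgapθ σ t h0σ hgap
    linarith

/-- Theorem 4(b): strong `(h⁰,h)`-ISS under a maximum dwell time, with
stabilizing jumps and destabilizing nonlinear continuous dynamics. -/
theorem stmt9 {n m : ℕ} {Λ : Type*} (γ : Λ → Set ℝ)
    (f g : Λ → ℝ → Stt n → Stt m → Stt n)
    (hγ : ∀ l : Λ, IsImpulseSeq (γ l))
    (h0 h : ℝ → Stt n → ℝ)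
    (hh0 : ∀ (t : ℝ) (ξ : Stt n), 0 ≤ t → 0 ≤ h0 t ξ)
    (hh : ∀ (t : ℝ) (ξ : Stt n), 0 ≤ t → 0 ≤ h t ξ)
    (V Vm : Λ → ℝ → Stt n → ℝ) (φ1 φ2 χ π : ℝ → ℝ)
    (p φb αb : ℝ → ℝ)
    (hp : LocIntegrable p) (hpnn : ∀ t : ℝ, 0 ≤ t → 0 ≤ p t)
    (hφbc : ContinuousOn φb (Set.Ici 0)) (hαb : PosDef αb)
    (hA1 : Assumption1 γ f g h0 h V Vm φ1 φ2 χ π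
      (fun _ t r => p t * φb r) (fun _ _ r => αb r))
    (hφbnd : PosDef fun r => -(φb r))
    (θ : ℝ) (hθ : 0 < θ)
    (hΓθ : ∀ l : Λ, (∃ s ∈ γ l, s ≤ θ) ∧
      ∀ s ∈ γ l, ∃ t ∈ γ l, s < t ∧ t ≤ s + θ)
    (hdiv : ¬ MeasureTheory.IntegrableOn (fun s => (-(φb s))⁻¹) (Set.Ici 1))
    (hbddP : BddAbove ((fun t => ∫ s in t..(t + θ), p s) '' Set.Ici 0))
    (hgt : sSup ((fun t => ∫ s in t..(t + θ), p s) '' Set.Ici 0) <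
      sInf ((fun a => ∫ s in (αb a)..a, (-(φb s))⁻¹) '' Set.Ioi 0)) :
    StronglyISS γ f g h0 h := by
  obtain ⟨hφ1, hφ2, hχ, hπ, hV, -, -, hbd, hdini, hj1, hj2⟩ := hA1
  obtain ⟨hq, -, hq0⟩ := hφbnd
  set M := sSup ((fun t => ∫ s in t..(t + θ), p s) '' Ici 0)
  set d := sInf ((fun a => ∫ s in (αb a)..a, (-(φb s))⁻¹) '' Ioi 0)
  have hpM : ∀ t, 0 ≤ t → ∫ s in t..(t + θ), p s ≤ M := fun t ht =>
    le_csSup hbddP (mem_image_of_mem (fun t => ∫ s in t..(t + θ), p s) ht)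
  have hM : 0 ≤ M := by
    refine le_trans ?_ (hpM 0 le_rfl)
    exact intervalIntegral.integral_nonneg (by linarith) fun s hs => hpnn s hs.1
  have hd : 0 < d := hM.trans_lt hgt
  have hbelow : BddBelow ((fun a => ∫ s in (αb a)..a, (-(φb s))⁻¹) '' Ioi 0) := by
    by_contra hc
    exact hd.ne' (Real.sInf_of_not_bddBelow hc)
  obtain ⟨Fn, hFd, hFm, hFs, hFα⟩ := exists_primitive_inv hq hq0 hαb.2.2 hd
    (fun a ha => csInf_le hbelow
      (mem_image_of_mem (fun a => ∫ s in (αb a)..a, (-(φb s))⁻¹) ha)) hdiv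
  obtain ⟨ψ, hψ, hψφ⟩ := hφ1.exists_inverse
  have hδ : 0 < d - M := by linarith
  have hθ1 : 0 < θ + 1 := by linarith
  refine ⟨_, _, hψ.classKL_shiftAlong hφ2 hFm hFs (M + (d - M)) (div_pos hδ hθ1),
    hψ.comp ((shiftAlong_classKInf hFm hFs M).comp (hχ.add hπ)), ?_⟩
  intro l t0 x0 u T x ht0 hu hx t ht htT
  obtain ⟨hW, hn⟩ := hx.1.lyapunov_le (hγ l) (hV l) hχ hπ hαb.2.2
    (fun t ξ μ h1 h2 h3 => (hdini l t ξ μ h1 h2 h3).trans_eq (mul_neg _ _).symm)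
    (hj1 l) (hj2 l) hq hq0 hFd hFm hFs hFα hp hpnn (hΓθ l) hpM hgt.le hu ht0 ht htT
  have ht' : 0 ≤ t := ht0.trans ht
  have hht := hh t (x t) ht'
  have h1 := (hbd l t (x t) ht').1
  have h2 := (hbd l t0 x0 ht0).2
  have hVt : 0 ≤ V l t (x t) := (hφ1.nonneg hht).trans h1
  have hV0 : 0 ≤ V l t0 x0 := (hφ1.nonneg (hh t0 x0 ht0)).trans (hbd l t0 x0 ht0).1
  have hrate : M - nJumps (γ l) t0 t * (d - M) ≤
      M + (d - M) - (d - M) / (θ + 1) * (t - t0 + nJumps (γ l) t0 t) := by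
    have h3 : (d - M) / (θ + 1) * (t - t0 + nJumps (γ l) t0 t) ≤
        (d - M) / (θ + 1) * ((nJumps (γ l) t0 t + 1) * (θ + 1)) :=
      mul_le_mul_of_nonneg_left (by linarith) (div_pos hδ hθ1).le
    have h4 : (d - M) / (θ + 1) * ((nJumps (γ l) t0 t + 1) * (θ + 1)) =
        (nJumps (γ l) t0 t + 1) * (d - M) := by
      field_simp
    linarith
  have hS := hW.trans (max_le_max_left _ (((shiftAlong_mono_right hFm hFs _) hrate).trans
    ((shiftAlong_classKInf hFm hFs _).2.1.monotoneOn hV0 (hV0.trans h2) h2)))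
  have hmono : ∀ r s, 0 ≤ r → 0 ≤ s → r ≤ s → ψ r ≤ ψ s := fun r s hr hs hrs =>
    hψ.2.1.monotoneOn hr hs hrs
  have hh' : h t (x t) ≤ ψ (V l t (x t)) :=
    (hψφ _ hht).symm.trans_le (hmono _ _ (hφ1.nonneg hht) hVt h1)
  have hnn := fun r a => hψ.nonneg (shiftAlong_nonneg hFs r a)
  rcases le_max_iff.1 hS with hc | hc
  · exact (hh'.trans (hmono _ _ hVt (shiftAlong_nonneg hFs _ _) hc)).trans
      (le_add_of_nonneg_left (hnn _ _))
  · exact (hh'.trans (hmono _ _ hVt (shiftAlong_nonneg hFs _ _) hc)).trans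
      (le_add_of_nonneg_right (hnn _ _))

end
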